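/- arXiv:1203.1437 — 2 statements merged into one kernel-verified Lean document; each statement's English description precedes it below -/
import Mathlib

section
/- For all smooth functions K, H : ℝ³ → ℝ, the Jacobi–Lie bracket of their contact Hamiltonian vector fields satisfies [X_K, X_H] = −X_{{K,H}_c}, where {K,H}_c is the Lagrange (contact Poisson) bracket. In particular, contact vector fields on (ℝ³, σ) are closed under the Jacobi–Lie bracket, and F ↦ X_F is a one-to-one correspondence intertwining (up to sign) the Lagrange bracket with the Jacobi–Lie bracket. -/
noncomputable section

/-- The contact manifold `ℝ³` with coordinates `(q,p,s)`. -/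
abbrev C3 := ℝ × ℝ × ℝ

def dQ (H : C3 → ℝ) (z : C3) : ℝ := fderiv ℝ H z (1, 0, 0)
def dP (H : C3 → ℝ) (z : C3) : ℝ := fderiv ℝ H z (0, 1, 0)
def dS (H : C3 → ℝ) (z : C3) : ℝ := fderiv ℝ H z (0, 0, 1)

/-- Contact Hamiltonian vector field
`X_H = (∂H/∂p, −(∂H/∂q + p ∂H/∂s), p ∂H/∂p − H)`. -/
def Xcon (H : C3 → ℝ) (z : C3) : C3 :=
  (dP H z, -(dQ H z + z.2.1 * dS H z), z.2.1 * dP H z - H z)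

/-- Lagrange (contact Poisson) bracket
`{K,H}_c = H_p K_q − H_q K_p + K_s (p H_p − H) + H_s (K − p K_p)`. -/
def lagBracket (K H : C3 → ℝ) (z : C3) : ℝ :=
  dP H z * dQ K z - dQ H z * dP K z + dS K z * (z.2.1 * dP H z - H z) +
    dS H z * (K z - z.2.1 * dP K z)

/-- Jacobi–Lie bracket `[X,Y](z) = DY(z) X(z) − DX(z) Y(z)`. -/
def jacobiLie {E : Type*} [NormedAddCommGroup E] [NormedSpace ℝ E] (X Y : E → E) : E → E :=
  fun z => fderiv ℝ Y z (X z) - fderiv ℝ X z (Y z)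

/-- A linear map on `ℝ³` is determined by its values on the coordinate vectors. -/
theorem map_eq_coordinates {F : Type*} [NormedAddCommGroup F] [NormedSpace ℝ F]
    (L : C3 →L[ℝ] F) (v : C3) :
    L v = v.1 • L (1, 0, 0) + v.2.1 • L (0, 1, 0) + v.2.2 • L (0, 0, 1) := by
  rw [← map_smul, ← map_smul, ← map_smul, ← map_add, ← map_add]
  congr 1
  ext <;> simp

theorem hasFDerivAt_fderiv_apply {E F : Type*} [NormedAddCommGroup E] [NormedSpace ℝ E]
    [NormedAddCommGroup F] [NormedSpace ℝ F] {H : E → F} (hH : ContDiff ℝ 2 H) (e z : E) :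
    HasFDerivAt (fun w => fderiv ℝ H w e) ((fderiv ℝ (fderiv ℝ H) z).flip e) z := by
  have h : DifferentiableAt ℝ (fderiv ℝ H) z :=
    (hH.fderiv_right (m := 1) (by norm_num)).differentiable (by norm_num) z
  simpa using h.hasFDerivAt.clm_apply (hasFDerivAt_const e z)

theorem hasFDerivAt_momentum (z : C3) :
    HasFDerivAt (fun w : C3 => w.2.1)
      ((ContinuousLinearMap.fst ℝ ℝ ℝ).comp (ContinuousLinearMap.snd ℝ ℝ (ℝ × ℝ))) z :=
  ContinuousLinearMap.hasFDerivAt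
    ((ContinuousLinearMap.fst ℝ ℝ ℝ).comp (ContinuousLinearMap.snd ℝ ℝ (ℝ × ℝ)))

theorem fderiv_Xcon_apply {H : C3 → ℝ} (hH : ContDiff ℝ 2 H) (z v : C3) :
    fderiv ℝ (Xcon H) z v =
      (fderiv ℝ (fderiv ℝ H) z v (0, 1, 0),
        -(fderiv ℝ (fderiv ℝ H) z v (1, 0, 0) +
          (z.2.1 * fderiv ℝ (fderiv ℝ H) z v (0, 0, 1) + v.2.1 * dS H z)),
        z.2.1 * fderiv ℝ (fderiv ℝ H) z v (0, 1, 0) + v.2.1 * dP H z - fderiv ℝ H z v) := by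
  have hd := (hH.differentiable (by norm_num) z).hasFDerivAt
  have hq := hasFDerivAt_fderiv_apply hH (1, 0, 0) z
  have hp := hasFDerivAt_fderiv_apply hH (0, 1, 0) z
  have hs := hasFDerivAt_fderiv_apply hH (0, 0, 1) z
  have hm := hasFDerivAt_momentum z
  have h : HasFDerivAt (Xcon H) _ z :=
    hp.prodMk ((hq.add (hm.mul hs)).neg.prodMk ((hm.mul hp).sub hd))
  rw [h.fderiv]
  simp [dS, dP, mul_comm]

theorem fderiv_lagBracket_apply {K H : C3 → ℝ} (hK : ContDiff ℝ 2 K) (hH : ContDiff ℝ 2 H)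
    (z v : C3) :
    fderiv ℝ (lagBracket K H) z v =
      (dP H z * fderiv ℝ (fderiv ℝ K) z v (1, 0, 0) +
          fderiv ℝ (fderiv ℝ H) z v (0, 1, 0) * dQ K z) -
        (dQ H z * fderiv ℝ (fderiv ℝ K) z v (0, 1, 0) +
          fderiv ℝ (fderiv ℝ H) z v (1, 0, 0) * dP K z) +
        (dS K z * (z.2.1 * fderiv ℝ (fderiv ℝ H) z v (0, 1, 0) + v.2.1 * dP H z -
            fderiv ℝ H z v) +
          fderiv ℝ (fderiv ℝ K) z v (0, 0, 1) * (z.2.1 * dP H z - H z)) +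
        (dS H z * (fderiv ℝ K z v -
            (z.2.1 * fderiv ℝ (fderiv ℝ K) z v (0, 1, 0) + v.2.1 * dP K z)) +
          fderiv ℝ (fderiv ℝ H) z v (0, 0, 1) * (K z - z.2.1 * dP K z)) := by
  have hd := (hH.differentiable (by norm_num) z).hasFDerivAt
  have hq := hasFDerivAt_fderiv_apply hH (1, 0, 0) z
  have hp := hasFDerivAt_fderiv_apply hH (0, 1, 0) z
  have hs := hasFDerivAt_fderiv_apply hH (0, 0, 1) z
  have kd := (hK.differentiable (by norm_num) z).hasFDerivAt
  have kq := hasFDerivAt_fderiv_apply hK (1, 0, 0) z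
  have kp := hasFDerivAt_fderiv_apply hK (0, 1, 0) z
  have ks := hasFDerivAt_fderiv_apply hK (0, 0, 1) z
  have hm := hasFDerivAt_momentum z
  have h : HasFDerivAt (lagBracket K H) _ z :=
    (((hp.mul kq).sub (hq.mul kp)).add (ks.mul ((hm.mul hp).sub hd))).add
      (hs.mul (kd.sub (hm.mul kp)))
  rw [h.fderiv]
  simp [dS, dP, dQ]
  ring

theorem jacobiLie_Xcon {K H : C3 → ℝ} (hK : ContDiff ℝ 2 K) (hH : ContDiff ℝ 2 H) (z : C3) :
    jacobiLie (Xcon K) (Xcon H) z = -(Xcon (lagBracket K H) z) := by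
  have sK : IsSymmSndFDerivAt ℝ K z := hK.contDiffAt.isSymmSndFDerivAt (by simp)
  have sH : IsSymmSndFDerivAt ℝ H z := hH.contDiffAt.isSymmSndFDerivAt (by simp)
  have k₁ := sK.eq (1, 0, 0) (0, 1, 0)
  have k₂ := sK.eq (1, 0, 0) (0, 0, 1)
  have k₃ := sK.eq (0, 1, 0) (0, 0, 1)
  have h₁ := sH.eq (1, 0, 0) (0, 1, 0)
  have h₂ := sH.eq (1, 0, 0) (0, 0, 1)
  have h₃ := sH.eq (0, 1, 0) (0, 0, 1)
  rw [jacobiLie, fderiv_Xcon_apply hH, fderiv_Xcon_apply hK,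
    map_eq_coordinates (fderiv ℝ (fderiv ℝ H) z) (Xcon K z),
    map_eq_coordinates (fderiv ℝ (fderiv ℝ K) z) (Xcon H z),
    map_eq_coordinates (fderiv ℝ H z) (Xcon K z),
    map_eq_coordinates (fderiv ℝ K z) (Xcon H z)]
  ext <;>
  · simp only [Xcon, dP, dQ, dS, fderiv_lagBracket_apply hK hH, lagBracket, Prod.fst_sub,
      Prod.snd_sub, Prod.fst_neg, Prod.snd_neg, add_apply, smul_apply, smul_eq_mul,
      k₁, k₂, k₃, h₁, h₂, h₃]
    ring

theorem Xcon_injective : Function.Injective (fun F : C3 → ℝ => Xcon F) := by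
  intro F G h
  funext z
  have hz : Xcon F z = Xcon G z := congrFun h z
  simp only [Xcon, Prod.mk.injEq] at hz
  obtain ⟨hp, -, hs⟩ := hz
  rw [hp] at hs
  linarith

/-- `[X_K, X_H] = −X_{{K,H}_c}`, and `F ↦ X_F` is one-to-one. -/
theorem stmt14 :
    (∀ K H : C3 → ℝ, ContDiff ℝ (⊤ : ℕ∞) K → ContDiff ℝ (⊤ : ℕ∞) H →
      jacobiLie (Xcon K) (Xcon H) = fun z => -(Xcon (lagBracket K H) z)) ∧
    Function.Injective (fun F : C3 → ℝ => Xcon F) := by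
  refine ⟨fun K H hK hH => ?_, Xcon_injective⟩
  funext z
  exact jacobiLie_Xcon (contDiff_infty.1 hK 2) (contDiff_infty.1 hH 2) z
end
end

section
/- Let F, H : ℝ³ → ℝ be smooth and let K : ℝ³ → ℝ be smooth and compactly supported. Then ∫_{ℝ³} F·{H,K}_c dq dp ds = ∫_{ℝ³} ({F,H}_c + 2 div(X_H)·F)·K dq dp ds, where div(X_H) = −2∂H/∂s is the Euclidean divergence of the contact Hamiltonian vector field X_H. That is, the coadjoint action on density functions dual to the Lagrange bracket algebra is given by ad*_H F = {F,H}_c + 2 div(X_H) F. -/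
open MeasureTheory

noncomputable section

/-- Euclidean divergence. -/
def divC (X : C3 → C3) (z : C3) : ℝ :=
  fderiv ℝ (fun w => (X w).1) z (1, 0, 0) + fderiv ℝ (fun w => (X w).2.1) z (0, 1, 0) +
    fderiv ℝ (fun w => (X w).2.2) z (0, 0, 1)

lemma integrable_fderiv_apply {G : C3 → ℝ} (hG : ContDiff ℝ 1 G)
    (hGc : HasCompactSupport G) (v : C3) : Integrable (fun z => fderiv ℝ G z v) :=
  ((hG.continuous_fderiv one_ne_zero).clm_apply continuous_const).integrable_of_hasCompactSupport
    (hGc.fderiv_apply (𝕜 := ℝ) v)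

/-- The integral of a directional derivative of a compactly supported function vanishes. -/
lemma integral_fderiv_apply_eq_zero {G : C3 → ℝ} (hG : ContDiff ℝ 1 G)
    (hGc : HasCompactSupport G) (v : C3) : ∫ z, fderiv ℝ G z v = 0 := by
  have hInt := integrable_fderiv_apply hG hGc v
  have : (volume : Measure (ℝ × ℝ)).IsAddHaarMeasure := Measure.prod.instIsAddHaarMeasure _ _
  have : (volume : Measure C3).IsAddHaarMeasure := Measure.prod.instIsAddHaarMeasure _ _
  have h := integral_mul_fderiv_eq_neg_fderiv_mul_of_integrable (μ := (volume : Measure C3))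
    (f := G) (g := fun _ => (1 : ℝ)) (v := v) (by simpa using hInt) (by simp)
    (by simpa using hG.continuous.integrable_of_hasCompactSupport hGc)
    (fun _ _ => hG.differentiable one_ne_zero _) (by fun_prop)
  simpa using h

/-- The divergence theorem for compactly supported vector fields. -/
lemma integrable_divC_and_integral_eq_zero {Y : C3 → C3} (hY : ContDiff ℝ 1 Y)
    (hYc : HasCompactSupport Y) : Integrable (divC Y) ∧ ∫ z, divC Y z = 0 := by
  have h1 : ContDiff ℝ 1 (fun z => (Y z).1) := by fun_prop
  have h2 : ContDiff ℝ 1 (fun z => (Y z).2.1) := by fun_prop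
  have h3 : ContDiff ℝ 1 (fun z => (Y z).2.2) := by fun_prop
  have c1 : HasCompactSupport (fun z => (Y z).1) := hYc.comp_left (g := fun y : C3 => y.1) rfl
  have c2 : HasCompactSupport (fun z => (Y z).2.1) := hYc.comp_left (g := fun y : C3 => y.2.1) rfl
  have c3 : HasCompactSupport (fun z => (Y z).2.2) := hYc.comp_left (g := fun y : C3 => y.2.2) rfl
  have i1 := integrable_fderiv_apply h1 c1 (1, 0, 0)
  have i2 := integrable_fderiv_apply h2 c2 (0, 1, 0)
  have i3 := integrable_fderiv_apply h3 c3 (0, 0, 1)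
  refine ⟨(i1.add i2).add i3, ?_⟩
  unfold divC
  rw [integral_add (by exact i1.add i2) i3, integral_add i1 i2,
    integral_fderiv_apply_eq_zero h1 c1, integral_fderiv_apply_eq_zero h2 c2,
    integral_fderiv_apply_eq_zero h3 c3]
  simp

lemma divC_smul {W : C3 → ℝ} {X : C3 → C3} {z : C3} (hW : DifferentiableAt ℝ W z)
    (hX : DifferentiableAt ℝ X z) :
    divC (fun w => W w • X w) z =
      dQ W z * (X z).1 + dP W z * (X z).2.1 + dS W z * (X z).2.2 + W z * divC X z := by
  have h1 : DifferentiableAt ℝ (fun z => (X z).1) z := by fun_prop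
  have h2 : DifferentiableAt ℝ (fun z => (X z).2.1) z := by fun_prop
  have h3 : DifferentiableAt ℝ (fun z => (X z).2.2) z := by fun_prop
  simp only [divC, dQ, dP, dS, Prod.smul_fst, Prod.smul_snd, smul_eq_mul]
  rw [fderiv_fun_mul hW h1, fderiv_fun_mul hW h2, fderiv_fun_mul hW h3]
  simp only [add_apply, smul_apply, smul_eq_mul]
  ring

lemma fderiv_mul_apply {F K : C3 → ℝ} {z : C3} (hF : DifferentiableAt ℝ F z)
    (hK : DifferentiableAt ℝ K z) (v : C3) :
    fderiv ℝ (fun w => F w * K w) z v = F z * fderiv ℝ K z v + K z * fderiv ℝ F z v := by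
  rw [fderiv_fun_mul hF hK]
  simp

lemma contDiff_Xcon {H : C3 → ℝ} (hH : ContDiff ℝ 2 H) : ContDiff ℝ 1 (Xcon H) := by
  have h : ∀ v : C3, ContDiff ℝ 1 (fun z => fderiv ℝ H z v) := fun v =>
    (hH.fderiv_right (m := 1) (by norm_num)).clm_apply contDiff_const
  have hQ : ContDiff ℝ 1 (dQ H) := h _
  have hP : ContDiff ℝ 1 (dP H) := h _
  have hS : ContDiff ℝ 1 (dS H) := h _
  have hH' : ContDiff ℝ 1 H := hH.of_le (by norm_num)
  unfold Xcon
  fun_prop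

/-- The divergence of a contact Hamiltonian vector field is `-2 ∂H/∂s`. -/
lemma divC_Xcon {H : C3 → ℝ} (hH : ContDiff ℝ 2 H) (z : C3) :
    divC (Xcon H) z = -2 * dS H z := by
  have hd : DifferentiableAt ℝ (fderiv ℝ H) z :=
    (hH.fderiv_right (m := 1) (by norm_num)).differentiable one_ne_zero z
  have hsymm : ∀ v w : C3, fderiv ℝ (fderiv ℝ H) z v w = fderiv ℝ (fderiv ℝ H) z w v :=
    (hH.contDiffAt (x := z)).isSymmSndFDerivAt (by simp)
  have hv : ∀ v w : C3, fderiv ℝ (fun y => fderiv ℝ H y v) z w =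
      fderiv ℝ (fderiv ℝ H) z w v := fun v w => by
    rw [fderiv_clm_apply hd (differentiableAt_const v)]
    simp
  have hdv : ∀ v : C3, DifferentiableAt ℝ (fun y => fderiv ℝ H y v) z := fun v =>
    hd.clm_apply (differentiableAt_const v)
  have hH1 : DifferentiableAt ℝ H z := hH.differentiable two_ne_zero z
  have hp : DifferentiableAt ℝ (fun y : C3 => y.2.1) z := by fun_prop
  have hp' : ∀ v : C3, fderiv ℝ (fun y : C3 => y.2.1) z v = v.2.1 := fun v => by
    rw [((hasFDerivAt_id z).snd.fst).fderiv]
    simp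
  simp only [divC, Xcon, dQ, dP, dS]
  rw [fderiv_fun_neg, fderiv_fun_add (hdv _) (hp.fun_mul (hdv _)), fderiv_fun_mul hp (hdv _),
    fderiv_fun_sub (hp.fun_mul (hdv _)) hH1, fderiv_fun_mul hp (hdv _)]
  simp only [neg_apply, add_apply, sub_apply, smul_apply, smul_eq_mul, hv, hp']
  rw [hsymm (1, 0, 0) (0, 1, 0), hsymm (0, 0, 1) (0, 1, 0)]
  ring

/-- The coadjoint action on density functions dual to the Lagrange bracket algebra:
`∫ F·{H,K}_c = ∫ ({F,H}_c + 2 div(X_H)·F)·K` for `K` compactly supported. -/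
theorem stmt17 (F H K : C3 → ℝ) (hF : ContDiff ℝ (⊤ : ℕ∞) F) (hH : ContDiff ℝ (⊤ : ℕ∞) H)
    (hK : ContDiff ℝ (⊤ : ℕ∞) K) (hKc : HasCompactSupport K) :
    (∫ z : C3, F z * lagBracket H K z)
      = ∫ z : C3, (lagBracket F H z + 2 * divC (Xcon H) z * F z) * K z := by
  have hF1 : ContDiff ℝ 1 F := hF.of_le (by exact_mod_cast le_top)
  have hK1 : ContDiff ℝ 1 K := hK.of_le (by exact_mod_cast le_top)
  have hH2 : ContDiff ℝ 2 H := contDiff_infty.1 hH 2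
  have hX := contDiff_Xcon hH2
  have hdF := hF1.differentiable one_ne_zero
  have hdK := hK1.differentiable one_ne_zero
  have key : ∀ z, (lagBracket F H z + 2 * divC (Xcon H) z * F z) * K z =
      F z * lagBracket H K z + divC (fun w => (F w * K w) • Xcon H w) z := fun z => by
    rw [divC_smul ((hdF z).fun_mul (hdK z)) (hX.differentiable one_ne_zero z), divC_Xcon hH2]
    simp only [dQ, dP, dS, lagBracket, Xcon, fderiv_mul_apply (hdF z) (hdK z)]
    ring
  have hYc : HasCompactSupport (fun w => (F w * K w) • Xcon H w) := (hKc.mul_left).smul_right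
  have hY : ContDiff ℝ 1 (fun w => (F w * K w) • Xcon H w) := by fun_prop
  have hcont : Continuous (fun z => F z * lagBracket H K z) := by
    have h : ∀ {G : C3 → ℝ}, ContDiff ℝ 1 G → ∀ v : C3, Continuous (fun z => fderiv ℝ G z v) :=
      fun hG v => (hG.continuous_fderiv one_ne_zero).clm_apply continuous_const
    have hH1 : ContDiff ℝ 1 H := hH2.of_le (by norm_num)
    have hHv := h hH1
    have hKv := h hK1
    have := hF1.continuous
    have := hK1.continuous
    have := hH1.continuous
    unfold lagBracket dQ dP dS
    fun_prop
  have hsupp : HasCompactSupport (fun z => F z * lagBracket H K z) :=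
    HasCompactSupport.intro hKc.isCompact fun z hz => by
      have hK0 : K z = 0 := image_eq_zero_of_notMem_tsupport hz
      have hdK0 : fderiv ℝ K z = 0 :=
        image_eq_zero_of_notMem_tsupport fun h => hz (tsupport_fderiv_subset ℝ h)
      simp [lagBracket, dQ, dP, dS, hK0, hdK0]
  obtain ⟨hInt, hzero⟩ := integrable_divC_and_integral_eq_zero hY hYc
  simp only [key]
  rw [integral_add (hcont.integrable_of_hasCompactSupport hsupp) hInt, hzero, add_zero]
end
end
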